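/- Let G be a group, F an algebraically closed field of characteristic zero, and let L = ⊕_{g∈G} L_g be a finite dimensional G-graded Lie algebra over F. If L is graded simple, then the subgroup of G generated by Supp L is abelian and L is semisimple with a decomposition L = B_1 ⊕ ... ⊕ B_n into simple ideals B_1, ..., B_n that are pairwise isomorphic as Lie algebras. -/

import Mathlib

/-- A `G`-grading on a Lie algebra `L` over `F`: a vector space direct sum decomposition
`L = ⊕_{g ∈ G} 𝒜 g` such that `⁅𝒜 g, 𝒜 h⁆ ⊆ 𝒜 (g * h)` for all `g h : G`. -/
def IsLieGrading {G F L : Type*} [Group G] [Field F] [LieRing L] [LieAlgebra F L]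
    (𝒜 : G → Submodule F L) : Prop :=
  letI : DecidableEq G := Classical.decEq G
  DirectSum.IsInternal 𝒜 ∧
    ∀ g h : G, ∀ x ∈ 𝒜 g, ∀ y ∈ 𝒜 h, ⁅x, y⁆ ∈ 𝒜 (g * h)

/-- A subspace `V` of a `G`-graded Lie algebra is graded (homogeneous) if it is the
sum of its homogeneous components, i.e. `V = ⊕_{g ∈ G} (V ∩ L_g)`. -/
def IsGradedSubspace {G F L : Type*} [Group G] [Field F] [LieRing L] [LieAlgebra F L]
    (𝒜 : G → Submodule F L) (V : Submodule F L) : Prop :=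
  V = ⨆ g : G, 𝒜 g ⊓ V

/-- A `G`-graded Lie algebra is graded simple if `⁅L, L⁆ ≠ 0` and the only graded
ideals of `L` are `0` and `L`. -/
def IsGradedSimple {G F L : Type*} [Group G] [Field F] [LieRing L] [LieAlgebra F L]
    (𝒜 : G → Submodule F L) : Prop :=
  (∃ x y : L, ⁅x, y⁆ ≠ 0) ∧
    ∀ I : LieIdeal F L, IsGradedSubspace 𝒜 I.toSubmodule → I = ⊥ ∨ I = ⊤

section GradedSimple

variable {G F L : Type*} [Group G] [Field F] [LieRing L] [LieAlgebra F L]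
  {𝒜 : G → Submodule F L}

namespace IsLieGrading

lemma iSup_eq_top (h : IsLieGrading 𝒜) : iSup 𝒜 = ⊤ := by
  classical
  exact DirectSum.IsInternal.submodule_iSup_eq_top h.1

lemma iSupIndep (h : IsLieGrading 𝒜) : iSupIndep 𝒜 := by
  classical
  exact DirectSum.IsInternal.submodule_iSupIndep h.1

lemma lie_mem (h : IsLieGrading 𝒜) {a b : G} {x y : L} (hx : x ∈ 𝒜 a) (hy : y ∈ 𝒜 b) :
    ⁅x, y⁆ ∈ 𝒜 (a * b) :=
  h.2 a b x hx y hy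

lemma eq_of_mem (h : IsLieGrading 𝒜) {a b : G} {x : L} (hx : x ≠ 0) (ha : x ∈ 𝒜 a)
    (hb : x ∈ 𝒜 b) : a = b := by
  by_contra hab
  exact hx (Submodule.disjoint_def.mp (h.iSupIndep.pairwiseDisjoint hab) x ha hb)

@[elab_as_elim]
lemma induction_on (h : IsLieGrading 𝒜) {p : L → Prop} (x : L)
    (mem : ∀ g, ∀ y ∈ 𝒜 g, p y) (zero : p 0) (add : ∀ y z, p y → p z → p (y + z)) : p x :=
  Submodule.iSup_induction 𝒜 (motive := p) (h.iSup_eq_top ▸ Submodule.mem_top) mem zero add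

lemma commute_of_lie_ne_zero (h : IsLieGrading 𝒜) {a b : G} {x y : L} (hx : x ∈ 𝒜 a)
    (hy : y ∈ 𝒜 b) (hxy : ⁅x, y⁆ ≠ 0) : Commute a b := by
  refine h.eq_of_mem hxy (h.lie_mem hx hy) ?_
  rw [← lie_skew]
  exact neg_mem (h.lie_mem hy hx)

end IsLieGrading

/-- The iterated bracket `⁅x₁, ⁅x₂, …, ⁅xₙ, y⁆⁆⁆` of a list of homogeneous elements. -/
def iteratedLie (l : List (Σ g, 𝒜 g)) (y : L) : L :=
  l.foldr (fun a z => ⁅(a.2 : L), z⁆) y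

lemma iteratedLie_mem (h : IsLieGrading 𝒜) (l : List (Σ g, 𝒜 g)) {b : G} {y : L}
    (hy : y ∈ 𝒜 b) : iteratedLie l y ∈ 𝒜 ((l.map Sigma.fst).prod * b) := by
  induction l with
  | nil => simpa [iteratedLie] using hy
  | cons a l ih =>
    rw [List.map_cons, List.prod_cons, mul_assoc]
    exact h.lie_mem a.2.2 ih

/-- The degrees of the entries of a nonzero iterated bracket commute pairwise. -/
theorem pairwise_commute_of_iteratedLie_ne_zero (h : IsLieGrading 𝒜) {b : G} {y : L}
    (hy : y ∈ 𝒜 b) (l : List (Σ g, 𝒜 g)) (hl : iteratedLie l y ≠ 0) :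
    (∀ a ∈ l, Commute a.1 b) ∧ l.Pairwise (fun a c => Commute a.1 c.1) := by
  induction hn : l.length generalizing l with
  | zero =>
    obtain rfl := List.length_eq_zero_iff.mp hn
    simp
  | succ n ih =>
    match l, hl, hn with
    | [a], hl, _ =>
      simpa using h.commute_of_lie_ne_zero a.2.2 hy hl
    | a :: c :: l, hl, hn =>
      have hn' : l.length + 1 = n := by simpa using hn
      have htail : iteratedLie (c :: l) y ≠ 0 := by
        intro h0
        apply hl
        change ⁅(a.2 : L), iteratedLie (c :: l) y⁆ = 0
        rw [h0, lie_zero]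
      obtain ⟨hcb, hcl⟩ := ih (c :: l) htail (by simpa using hn')
      rw [List.pairwise_cons] at hcl
      have hcprod : Commute a.1 (((c :: l).map Sigma.fst).prod * b) :=
        h.commute_of_lie_ne_zero a.2.2 (iteratedLie_mem h (c :: l) hy) hl
      suffices Commute a.1 c.1 ∧ Commute a.1 b ∧ ∀ d ∈ l, Commute a.1 d.1 by
        obtain ⟨h1, h2, h3⟩ := this
        refine ⟨?_, ?_⟩
        · rintro d (_ | ⟨_, hd⟩)
          · exact h2
          · exact hcb d hd
        · rw [List.pairwise_cons, List.pairwise_cons]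
          refine ⟨?_, hcl⟩
          rintro d (_ | ⟨_, hd⟩)
          · exact h1
          · exact h3 d hd
      by_cases hac : ⁅(a.2 : L), (c.2 : L)⁆ = 0
      · have hal : iteratedLie (a :: l) y ≠ 0 := by
          intro h0
          apply hl
          change ⁅(a.2 : L), ⁅(c.2 : L), iteratedLie l y⁆⁆ = 0
          change ⁅(a.2 : L), iteratedLie l y⁆ = 0 at h0
          rw [leibniz_lie, hac, h0, zero_lie, lie_zero, add_zero]
        obtain ⟨hab, hall⟩ := ih (a :: l) hal (by simpa using hn')
        rw [List.pairwise_cons] at hall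
        have hb : Commute a.1 b := hab a (by simp)
        have hprod : Commute a.1 ((l.map Sigma.fst).prod * b) := by
          refine Commute.mul_right (Commute.list_prod_right _ _ ?_) hb
          intro d hd
          obtain ⟨k, hk, rfl⟩ := List.mem_map.mp hd
          exact hall.1 k hk
        rw [List.map_cons, List.prod_cons, mul_assoc] at hcprod
        refine ⟨?_, hb, hall.1⟩
        have := hcprod.mul_right hprod.inv_right
        rwa [mul_inv_cancel_right] at this
      · have hcomm : Commute a.1 c.1 := h.commute_of_lie_ne_zero a.2.2 c.2.2 hac
        by_cases h0 : ⁅⁅(a.2 : L), (c.2 : L)⁆, iteratedLie l y⁆ = 0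
        · have hal : iteratedLie (a :: l) y ≠ 0 := by
            intro h1
            apply hl
            change ⁅(a.2 : L), ⁅(c.2 : L), iteratedLie l y⁆⁆ = 0
            change ⁅(a.2 : L), iteratedLie l y⁆ = 0 at h1
            rw [leibniz_lie, h0, h1, lie_zero, add_zero]
          obtain ⟨hab, hall⟩ := ih (a :: l) hal (by simpa using hn')
          rw [List.pairwise_cons] at hall
          exact ⟨hcomm, hab a (by simp), hall.1⟩
        · obtain ⟨hab, hall⟩ :=
            ih (⟨a.1 * c.1, ⟨_, h.lie_mem a.2.2 c.2.2⟩⟩ :: l) h0 (by simpa using hn')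
          rw [List.pairwise_cons] at hall
          have key : ∀ d : G, Commute (a.1 * c.1) d → Commute c.1 d → Commute a.1 d := by
            intro d h1 h2
            have := h1.mul_left h2.inv_left
            rwa [mul_inv_cancel_right] at this
          exact ⟨hcomm, key b (hab _ List.mem_cons_self) (hcb c (by simp)),
            fun d hd => key d.1 (hall.1 d hd) (hcl.1 d hd)⟩

/-- The ideal generated by a homogeneous element, as the span of iterated brackets. -/
def iteratedLieIdeal (h : IsLieGrading 𝒜) (x : L) : LieIdeal F L where
  toSubmodule := Submodule.span F (Set.range fun l : List (Σ g, 𝒜 g) => iteratedLie l x)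
  lie_mem := by
    intro z m hm
    change ⁅z, m⁆ ∈ Submodule.span F _
    change m ∈ Submodule.span F _ at hm
    induction z using h.induction_on with
    | zero => simp
    | add y z hy hz => rw [add_lie]; exact add_mem hy hz
    | mem g z hz =>
      induction hm using Submodule.span_induction with
      | mem w hw =>
        obtain ⟨l, rfl⟩ := hw
        exact Submodule.subset_span ⟨⟨g, z, hz⟩ :: l, rfl⟩
      | zero => simp
      | add u v _ _ hu hv => rw [lie_add]; exact add_mem hu hv
      | smul t u _ hu => rw [lie_smul]; exact Submodule.smul_mem _ _ hu

lemma isGradedSubspace_span {S : Set L} (hS : ∀ x ∈ S, ∃ g, x ∈ 𝒜 g) :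
    IsGradedSubspace 𝒜 (Submodule.span F S) := by
  refine le_antisymm (Submodule.span_le.mpr fun x hx => ?_) (iSup_le fun g => inf_le_right)
  obtain ⟨g, hg⟩ := hS x hx
  exact Submodule.mem_iSup_of_mem g ⟨hg, Submodule.subset_span hx⟩

/-- The support of a graded simple Lie algebra is commutative. -/
theorem IsGradedSimple.commute (h : IsLieGrading 𝒜) (hs : IsGradedSimple 𝒜) {a b : G}
    (ha : 𝒜 a ≠ ⊥) (hb : 𝒜 b ≠ ⊥) : Commute a b := by
  obtain ⟨x, hx, hx0⟩ := Submodule.exists_mem_ne_zero_of_ne_bot ha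
  have hxI : x ∈ iteratedLieIdeal h x := Submodule.subset_span ⟨[], rfl⟩
  have htop : iteratedLieIdeal h x = ⊤ := by
    refine (hs.2 _ (isGradedSubspace_span ?_)).resolve_left fun hbot => hx0 ?_
    · rintro _ ⟨l, rfl⟩
      exact ⟨_, iteratedLie_mem h l hx⟩
    · rw [hbot] at hxI
      exact (LieSubmodule.mem_bot x).mp hxI
  have hle : (iteratedLieIdeal h x).toSubmodule ≤ ⨆ g ∈ {g : G | Commute g a}, 𝒜 g := by
    refine Submodule.span_le.mpr ?_
    rintro _ ⟨l, rfl⟩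
    by_cases hl : iteratedLie l x = 0
    · simp only [hl]
      exact zero_mem _
    · have hc := (pairwise_commute_of_iteratedLie_ne_zero h hx l hl).1
      refine Submodule.mem_iSup_of_mem _ (Submodule.mem_iSup_of_mem ?_ (iteratedLie_mem h l hx))
      refine Commute.mul_left (Commute.list_prod_left _ _ ?_) (Commute.refl a)
      intro d hd
      obtain ⟨k, hk, rfl⟩ := List.mem_map.mp hd
      exact hc k hk
  by_contra hab
  have hdisj := h.iSupIndep.disjoint_biSup (x := b) (y := {g : G | Commute g a})
    fun hba => hab (Commute.symm hba)
  rw [htop, LieSubmodule.top_toSubmodule, top_le_iff] at hle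
  rw [hle, disjoint_top] at hdisj
  exact hb hdisj

/-- A subspace is graded as soon as it contains the homogeneous components of its elements. -/
lemma IsLieGrading.isGradedSubspace_of_forall (h : IsLieGrading 𝒜) {V : Submodule F L}
    (hV : ∀ y : G →₀ L, (∀ g, y g ∈ 𝒜 g) → (y.sum fun _ z => z) ∈ V → ∀ g, y g ∈ V) :
    IsGradedSubspace 𝒜 V := by
  refine le_antisymm (fun x hx => ?_) (iSup_le fun g => inf_le_right)
  obtain ⟨y, hy, rfl⟩ := (Submodule.mem_iSup_iff_exists_finsupp 𝒜 x).mp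
    (h.iSup_eq_top ▸ Submodule.mem_top)
  exact (Submodule.mem_iSup_iff_exists_finsupp _ _).mpr
    ⟨y, fun g => ⟨hy g, hV y hy hx g⟩, rfl⟩

lemma IsLieGrading.killingForm_eq_zero [FiniteDimensional F L] (h : IsLieGrading 𝒜) {a b : G}
    (hab : a * b ≠ 1) {x y : L} (hx : x ∈ 𝒜 a) (hy : y ∈ 𝒜 b) : killingForm F L x y = 0 := by
  classical
  rw [LieModule.traceForm_apply_apply]
  refine LinearMap.trace_eq_zero_of_mapsTo_ne h.1 (fun g => a * b * g) (by simpa using hab) ?_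
  intro g z hz
  have := h.lie_mem hx (h.lie_mem hy hz)
  rwa [← mul_assoc] at this

lemma IsLieGrading.isGradedSubspace_killingCompl [FiniteDimensional F L]
    (h : IsLieGrading 𝒜) :
    IsGradedSubspace 𝒜 (LieIdeal.killingCompl F L ⊤).toSubmodule := by
  refine h.isGradedSubspace_of_forall fun y hy hsum g => ?_
  rw [LieSubmodule.mem_toSubmodule, LieIdeal.mem_killingCompl] at hsum ⊢
  intro z _
  induction z using h.induction_on with
  | zero => simp
  | add u v hu hv => simp [hu trivial, hv trivial]
  | mem b z hz =>
    by_cases hgb : b * g = 1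
    · have h1 := hsum z trivial
      rw [Finsupp.sum, map_sum, Finset.sum_eq_single g] at h1
      · exact h1
      · intro k _ hk
        refine h.killingForm_eq_zero (fun hkb => hk ?_) hz (hy k)
        exact mul_left_cancel (hkb.trans hgb.symm)
      · intro hg
        rw [Finsupp.notMem_support_iff.mp hg, map_zero]
    · exact h.killingForm_eq_zero hgb hz (hy g)

lemma IsLieGrading.isGradedSubspace_derivedSeries (h : IsLieGrading 𝒜) :
    IsGradedSubspace 𝒜 (LieAlgebra.derivedSeries F L 1).toSubmodule := by
  refine le_antisymm ?_ (iSup_le fun g => inf_le_right)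
  set V := (LieAlgebra.derivedSeries F L 1).toSubmodule
  have hmem : ∀ x y : L, ⁅x, y⁆ ∈ V := fun x y =>
    LieSubmodule.lie_mem_lie (LieSubmodule.mem_top x) (LieSubmodule.mem_top y)
  have hspan : V = Submodule.span F {⁅x, y⁆ | (x ∈ (⊤ : LieIdeal F L)) (y ∈ (⊤ : LieIdeal F L))} :=
    LieSubmodule.lieIdeal_oper_eq_linear_span' _ _
  rw [hspan, Submodule.span_le, ← hspan]
  rintro _ ⟨x, -, y, -, rfl⟩
  rw [SetLike.mem_coe]
  induction x using h.induction_on with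
  | zero => simp
  | add u v hu hv => rw [add_lie]; exact add_mem hu hv
  | mem a x hx =>
    induction y using h.induction_on with
    | zero => simp
    | add u v hu hv => rw [lie_add]; exact add_mem hu hv
    | mem b y hy => exact Submodule.mem_iSup_of_mem (a * b) ⟨h.lie_mem hx hy, hmem x y⟩

/-- In characteristic zero, the Killing form of a finite dimensional graded simple Lie algebra is
nondegenerate. -/
theorem IsGradedSimple.isKilling [CharZero F] [FiniteDimensional F L] (h : IsLieGrading 𝒜)
    (hs : IsGradedSimple 𝒜) : LieAlgebra.IsKilling F L := by
  obtain ⟨x, y, hxy⟩ := hs.1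
  have hmem : ⁅x, y⁆ ∈ LieAlgebra.derivedSeries F L 1 :=
    LieSubmodule.lie_mem_lie (LieSubmodule.mem_top x) (LieSubmodule.mem_top y)
  refine ⟨(hs.2 _ h.isGradedSubspace_killingCompl).resolve_right fun htop => ?_⟩
  have hsolv : LieAlgebra.IsSolvable L := by
    refine LieAlgebra.isSolvable_of_killingForm_apply_lie_eq_zero (R := F) fun u v _ => ?_
    have hv : v ∈ LieIdeal.killingCompl F L ⊤ := by
      rw [htop]
      exact LieSubmodule.mem_top v
    exact (LieIdeal.mem_killingCompl F L ⊤).mp hv u trivial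
  have : Nontrivial L := ⟨_, _, hxy⟩
  rcases hs.2 _ h.isGradedSubspace_derivedSeries with h0 | h1
  · rw [h0] at hmem
    exact hxy ((LieSubmodule.mem_bot _).mp hmem)
  · exact (LieAlgebra.derivedSeries_lt_top_of_solvable F L).ne h1

end GradedSimple

section Characters

variable {F : Type*} [Field F] [IsAlgClosed F] [CharZero F]

lemma exists_unit_ne_one_pow_eq_one {n : ℕ} (hn : n ≠ 1) : ∃ u : Fˣ, u ≠ 1 ∧ u ^ n = 1 := by
  rcases Nat.eq_zero_or_pos n with rfl | hpos
  · exact ⟨-1, fun h => two_ne_zero (α := F) (by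
      have := congrArg (Units.val) h
      simp only [Units.val_neg, Units.val_one] at this
      linear_combination -this), pow_zero _⟩
  · have : NeZero n := ⟨hpos.ne'⟩
    have : NeZero (n : F) := ⟨Nat.cast_ne_zero.mpr hpos.ne'⟩
    obtain ⟨ζ, hζ⟩ := HasEnoughRootsOfUnity.exists_primitiveRoot F n
    obtain ⟨u, rfl⟩ := hζ.isUnit hpos.ne'
    exact ⟨u, fun h => hζ.ne_one (by omega) (by simp [h]), Units.ext (by simpa using hζ.pow_eq_one)⟩

/-- Characters with values in an algebraically closed field of characteristic zero separate the
points of an abelian group. -/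
theorem exists_monoidHom_units_apply_ne_one {A : Type*} [CommGroup A] {a : A} (ha : a ≠ 1) :
    ∃ χ : A →* Fˣ, χ a ≠ 1 := by
  obtain ⟨u, hu, hun⟩ := exists_unit_ne_one_pow_eq_one (F := F) (n := orderOf a)
    (by simpa using ha)
  let _ : RootableBy Fˣ ℕ := rootableByOfPowLeftSurj _ _ fun {n} hn v => by
    obtain ⟨z, hz⟩ := IsAlgClosed.exists_pow_nat_eq (v : F) (Nat.pos_of_ne_zero hn)
    have hz0 : z ≠ 0 := by
      rintro rfl
      rw [zero_pow hn] at hz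
      exact v.ne_zero hz.symm
    exact ⟨Units.mk0 z hz0, Units.ext (by simpa using hz)⟩
  let _ : DivisibleBy (Additive Fˣ) ℕ :=
    divisibleByOfSMulRightSurj _ _ fun hn => RootableBy.surjective_pow Fˣ ℕ hn
  let _ : DivisibleBy (Additive Fˣ) ℤ := AddGroup.divisibleByIntOfDivisibleByNat _
  let i : ZMod (orderOf a) →+ Additive A := ZMod.lift _ ⟨zmultiplesHom _ (Additive.ofMul a), by
    rw [zmultiplesHom_apply, natCast_zsmul, ← ofMul_pow, pow_orderOf_eq_one, ofMul_one]⟩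
  let f : ZMod (orderOf a) →+ Additive Fˣ := ZMod.lift _ ⟨zmultiplesHom _ (Additive.ofMul u), by
    rw [zmultiplesHom_apply, natCast_zsmul, ← ofMul_pow, hun, ofMul_one]⟩
  have hi : Function.Injective i := by
    rw [ZMod.lift_injective]
    intro m hm
    rw [zmultiplesHom_apply, ← ofMul_zpow, ofMul_eq_zero, ← orderOf_dvd_iff_zpow_eq_one] at hm
    rwa [ZMod.intCast_zmod_eq_zero_iff_dvd]
  obtain ⟨χ, hχ⟩ := (Module.Baer.of_divisible (Additive Fˣ)).extension_property_addMonoidHom i hi f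
  refine ⟨AddMonoidHom.toMultiplicative χ, fun h1 => hu ?_⟩
  have h2 : χ (i ((1 : ℤ) : ZMod (orderOf a))) = f ((1 : ℤ) : ZMod (orderOf a)) :=
    DFunLike.congr_fun hχ _
  have h3 : χ (Additive.ofMul a) = Additive.ofMul u := by
    simpa only [i, f, ZMod.lift_coe, zmultiplesHom_apply, one_zsmul] using h2
  exact Additive.ofMul.injective (h3.symm.trans (Additive.toMul.injective h1))

end Characters

section GradedAutomorphisms

variable {G F L : Type*} [Group G] [Field F] [LieRing L] [LieAlgebra F L]
  {𝒜 : G → Submodule F L}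

/-- A function on the grading group which is multiplicative on the support acts on the Lie algebra
by rescaling the homogeneous components. -/
lemma IsLieGrading.exists_lieHom (h : IsLieGrading 𝒜) (c : G → Fˣ)
    (hc : ∀ a b, 𝒜 a ≠ ⊥ → 𝒜 b ≠ ⊥ → c (a * b) = c a * c b) :
    ∃ φ : L →ₗ⁅F⁆ L, ∀ g, ∀ x ∈ 𝒜 g, φ x = (c g : F) • x := by
  let _ : DecidableEq G := Classical.decEq G
  let e := LinearEquiv.ofBijective (DirectSum.coeLinearMap 𝒜) h.1
  let ψ : L →ₗ[F] L :=
    (DirectSum.toModule F G L fun g => (c g : F) • (𝒜 g).subtype) ∘ₗ e.symm.toLinearMap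
  have hψ : ∀ g, ∀ x ∈ 𝒜 g, ψ x = (c g : F) • x := by
    intro g x hx
    have he : e.symm x = DirectSum.lof F G (fun g => 𝒜 g) g ⟨x, hx⟩ := by
      rw [LinearEquiv.symm_apply_eq]
      exact (DirectSum.coeLinearMap_lof 𝒜 g ⟨x, hx⟩).symm
    simp [ψ, he]
  refine ⟨{ ψ with map_lie' := ?_ }, hψ⟩
  intro x y
  change ψ ⁅x, y⁆ = ⁅ψ x, ψ y⁆
  induction x using h.induction_on with
  | zero => simp
  | add u v hu hv => simp [hu, hv]
  | mem a x hx =>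
    induction y using h.induction_on with
    | zero => simp
    | add u v hu hv => simp [hu, hv]
    | mem b y hy =>
      by_cases hx0 : x = 0
      · simp [hx0]
      by_cases hy0 : y = 0
      · simp [hy0]
      rw [hψ _ _ (h.lie_mem hx hy), hψ _ _ hx, hψ _ _ hy,
        hc a b ((Submodule.ne_bot_iff _).mpr ⟨x, hx, hx0⟩)
          ((Submodule.ne_bot_iff _).mpr ⟨y, hy, hy0⟩), smul_lie, lie_smul, smul_smul,
        Units.val_mul]

lemma IsLieGrading.exists_lieEquiv (h : IsLieGrading 𝒜) (c : G → Fˣ)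
    (hc : ∀ a b, 𝒜 a ≠ ⊥ → 𝒜 b ≠ ⊥ → c (a * b) = c a * c b) :
    ∃ φ : L ≃ₗ⁅F⁆ L, ∀ g, ∀ x ∈ 𝒜 g, φ x = (c g : F) • x := by
  obtain ⟨φ, hφ⟩ := h.exists_lieHom c hc
  obtain ⟨ψ, hψ⟩ := h.exists_lieHom c⁻¹ fun a b ha hb => by
    simp [hc a b ha hb, mul_comm]
  refine ⟨{ φ with invFun := ψ, left_inv := ?_, right_inv := ?_ }, hφ⟩
  · intro x
    change ψ (φ x) = x
    induction x using h.induction_on with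
    | zero => simp
    | add u v hu hv => rw [map_add, map_add, hu, hv]
    | mem g x hx => rw [hφ g x hx, map_smul, hψ g x hx, smul_smul]; simp
  · intro x
    change φ (ψ x) = x
    induction x using h.induction_on with
    | zero => simp
    | add u v hu hv => rw [map_add, map_add, hu, hv]
    | mem g x hx => rw [hψ g x hx, map_smul, hφ g x hx, smul_smul]; simp

open scoped IsMulCommutative in
/-- If the support of a grading is commutative, then subspaces invariant under all automorphisms
are graded. -/
theorem IsLieGrading.isGradedSubspace_of_invariant [IsAlgClosed F] [CharZero F]
    (h : IsLieGrading 𝒜) (hcomm : ∀ a b, 𝒜 a ≠ ⊥ → 𝒜 b ≠ ⊥ → Commute a b) {V : Submodule F L}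
    (hV : ∀ φ : L ≃ₗ⁅F⁆ L, ∀ x ∈ V, φ x ∈ V) : IsGradedSubspace 𝒜 V := by
  classical
  set A := Subgroup.closure {g : G | 𝒜 g ≠ ⊥}
  have : IsMulCommutative A :=
    Subgroup.isMulCommutative_closure fun a ha b hb => hcomm a b ha hb
  have hmemA : ∀ {g}, 𝒜 g ≠ ⊥ → g ∈ A := fun hg => Subgroup.subset_closure hg
  let ev : A → ((A →* Fˣ) →* F) := fun a =>
    (Units.coeHom F).comp (MonoidHom.eval a)
  have hev : Function.Injective ev := by
    intro a b hab
    by_contra hne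
    obtain ⟨χ, hχ⟩ := exists_monoidHom_units_apply_ne_one (F := F) (a := a / b)
      (by rwa [Ne, div_eq_one])
    apply hχ
    rw [map_div, div_eq_one]
    exact Units.ext (DFunLike.congr_fun hab χ)
  have hli : LinearIndependent F (fun a => (ev a : (A →* Fˣ) → F)) :=
    (linearIndependent_monoidHom (A →* Fˣ) F).comp ev hev
  refine h.isGradedSubspace_of_forall fun y hy hsum g => ?_
  by_contra hg
  obtain ⟨f, hf0, hfV⟩ := Submodule.exists_le_ker_of_notMem hg
  have hg0 : y g ≠ 0 := fun h0 => hg (h0 ▸ zero_mem V)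
  have hsupp : ∀ k ∈ y.support, k ∈ A := fun k hk =>
    hmemA ((Submodule.ne_bot_iff _).mpr ⟨y k, hy k, Finsupp.mem_support_iff.mp hk⟩)
  have hgA : g ∈ A := hsupp g (Finsupp.mem_support_iff.mpr hg0)
  have hzero := linearIndependent_iff'.mp hli (y.support.subtype (· ∈ A))
    (fun a => f (y a)) ?_ ⟨g, hgA⟩ (by simpa using hg0)
  · exact hf0 hzero
  funext χ
  let c : G → Fˣ := fun k => if hk : k ∈ A then χ ⟨k, hk⟩ else 1
  have hcA : ∀ {k} (hk : k ∈ A), c k = χ ⟨k, hk⟩ := fun hk => dif_pos hk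
  obtain ⟨φ, hφ⟩ := h.exists_lieEquiv c fun a b ha hb => by
    rw [hcA (hmemA ha), hcA (hmemA hb), hcA (mul_mem (hmemA ha) (hmemA hb)), ← map_mul]
    rfl
  have h0 : f (φ (y.sum fun _ z => z)) = 0 := hfV (hV φ _ hsum)
  rw [Finsupp.sum, map_sum, map_sum, ← Finset.sum_subtype_of_mem _ hsupp] at h0
  rw [Finset.sum_apply, Pi.zero_apply, ← h0]
  refine Finset.sum_congr rfl fun a _ => ?_
  rw [hφ a _ (hy a), hcA a.2, map_smul, Pi.smul_apply, smul_eq_mul, smul_eq_mul, mul_comm]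
  rfl

/-- The image of an ideal under an automorphism. -/
def LieIdeal.mapEquiv (φ : L ≃ₗ⁅F⁆ L) (I : LieIdeal F L) : LieIdeal F L where
  toSubmodule := I.toSubmodule.map (φ : L →ₗ[F] L)
  lie_mem := by
    rintro x _ ⟨y, hy, rfl⟩
    refine ⟨⁅φ.symm x, y⁆, I.lie_mem hy, ?_⟩
    change φ ⁅φ.symm x, y⁆ = ⁅x, φ y⁆
    rw [LieEquiv.map_lie, LieEquiv.apply_symm_apply]

lemma LieIdeal.mem_mapEquiv {φ : L ≃ₗ⁅F⁆ L} {I : LieIdeal F L} {x : L} :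
    x ∈ I.mapEquiv φ ↔ φ.symm x ∈ I := by
  constructor
  · rintro ⟨y, hy, rfl⟩
    change φ.symm (φ y) ∈ I
    rwa [LieEquiv.symm_apply_apply]
  · exact fun hx => ⟨φ.symm x, hx, φ.apply_symm_apply x⟩

/-- Ideals related by an automorphism are isomorphic as Lie algebras. -/
def LieIdeal.equivMapEquiv (φ : L ≃ₗ⁅F⁆ L) (I : LieIdeal F L) : I ≃ₗ⁅F⁆ I.mapEquiv φ where
  toFun x := ⟨φ x, x, x.2, rfl⟩
  invFun x := ⟨φ.symm x, LieIdeal.mem_mapEquiv.mp x.2⟩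
  left_inv x := by simp
  right_inv x := by simp
  map_add' x y := by ext; simp
  map_smul' t x := by ext; simp
  map_lie' {x y} := Subtype.ext (LieEquiv.map_lie φ x y)

/-- Automorphisms induce order automorphisms of the lattice of ideals. -/
def LieIdeal.mapOrderIso (φ : L ≃ₗ⁅F⁆ L) : LieIdeal F L ≃o LieIdeal F L where
  toFun := LieIdeal.mapEquiv φ
  invFun := LieIdeal.mapEquiv φ.symm
  left_inv I := by ext x; simp [LieIdeal.mem_mapEquiv]
  right_inv I := by ext x; simp [LieIdeal.mem_mapEquiv]
  map_rel_iff' {I J} := by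
    constructor
    · intro hIJ x hx
      have := @hIJ (φ x) (by simpa [LieIdeal.mem_mapEquiv] using hx)
      simpa [LieIdeal.mem_mapEquiv] using this
    · intro hIJ x hx
      exact LieIdeal.mem_mapEquiv.mpr (hIJ (LieIdeal.mem_mapEquiv.mp hx))

/-- The minimal ideals of a semisimple graded simple Lie algebra with commutative support are
pairwise isomorphic. -/
theorem IsGradedSimple.nonempty_lieEquiv [IsAlgClosed F] [CharZero F]
    [LieAlgebra.IsSemisimple F L] (h : IsLieGrading 𝒜) (hs : IsGradedSimple 𝒜)
    {I J : LieIdeal F L} (hI : IsAtom I) (hJ : IsAtom J) : Nonempty (I ≃ₗ⁅F⁆ J) := by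
  let S : Set (LieIdeal F L) := Set.range fun φ : L ≃ₗ⁅F⁆ L => I.mapEquiv φ
  have hIS : I ≤ sSup S := le_sSup ⟨LieEquiv.refl, by ext x; exact LieIdeal.mem_mapEquiv⟩
  have hgr : IsGradedSubspace 𝒜 (sSup S).toSubmodule := by
    refine h.isGradedSubspace_of_invariant (fun a b ha hb => hs.commute h ha hb) ?_
    intro φ x hx
    have hle : LieIdeal.mapOrderIso φ (sSup S) ≤ sSup S := by
      rw [OrderIso.map_sSup]
      refine iSup₂_le ?_
      rintro _ ⟨ψ, rfl⟩
      refine le_sSup ⟨ψ.trans φ, ?_⟩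
      ext z
      change z ∈ I.mapEquiv (ψ.trans φ) ↔ z ∈ (I.mapEquiv ψ).mapEquiv φ
      simp only [LieIdeal.mem_mapEquiv]
      rfl
    exact hle (show φ x ∈ (sSup S).mapEquiv φ from ⟨x, hx, rfl⟩)
  have htop : sSup S = ⊤ := (hs.2 _ hgr).resolve_left fun h0 => hI.1 (le_bot_iff.mp (h0 ▸ hIS))
  by_cases hJS : J ∈ S
  · obtain ⟨φ, rfl⟩ := hJS
    exact ⟨I.equivMapEquiv φ⟩
  · exfalso
    have hd := LieAlgebra.IsSemisimple.sSupIndep_isAtom (R := F) (L := L) hJ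
    refine hJ.1 (hd.eq_bot_of_le (le_top.trans (htop.ge.trans (sSup_le_sSup ?_))))
    rintro _ ⟨φ, rfl⟩
    refine ⟨(OrderIso.isAtom_iff (LieIdeal.mapOrderIso φ) I).mpr hI, ?_⟩
    rintro rfl
    exact hJS ⟨φ, rfl⟩

end GradedAutomorphisms

/-- A finite dimensional semisimple Lie algebra is the internal direct sum of its minimal ideals. -/
theorem LieAlgebra.IsSemisimple.exists_isInternal_isAtom (F L : Type*) [Field F] [LieRing L]
    [LieAlgebra F L] [FiniteDimensional F L] [LieAlgebra.IsSemisimple F L] :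
    ∃ (n : ℕ) (B : Fin n → LieIdeal F L),
      DirectSum.IsInternal (fun i => (B i).toSubmodule) ∧ ∀ i, IsAtom (B i) := by
  have hind := LieAlgebra.IsSemisimple.sSupIndep_isAtom (R := F) (L := L)
  have hfin : {I : LieIdeal F L | IsAtom I}.Finite := WellFoundedGT.finite_of_sSupIndep hind
  have := hfin.to_subtype
  obtain ⟨n, ⟨e⟩⟩ := Finite.exists_equiv_fin {I : LieIdeal F L | IsAtom I}
  refine ⟨n, fun i => (e.symm i).1, ?_, fun i => (e.symm i).2⟩
  rw [DirectSum.isInternal_submodule_iff_iSupIndep_and_iSup_eq_top,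
    LieSubmodule.iSupIndep_toSubmodule, LieSubmodule.iSup_toSubmodule_eq_top]
  refine ⟨((sSupIndep_iff _).mp hind).comp e.symm.injective, ?_⟩
  rw [e.symm.iSup_comp (g := fun I : {I : LieIdeal F L | IsAtom I} => I.1), ← sSup_eq_iSup']
  exact LieAlgebra.IsSemisimple.sSup_atoms_eq_top

/-- A finite dimensional graded simple Lie algebra over an algebraically
closed field of characteristic zero has commutative support (the subgroup generated by
the support is abelian), is semisimple, and decomposes into a direct sum of pairwise
isomorphic simple ideals. -/
theorem gradedSimple_structure {G F L : Type*} [Group G] [Field F] [IsAlgClosed F]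
    [CharZero F] [LieRing L] [LieAlgebra F L] [FiniteDimensional F L]
    (𝒜 : G → Submodule F L) (hgr : IsLieGrading 𝒜) (hs : IsGradedSimple 𝒜) :
    (∀ x ∈ Subgroup.closure {g : G | 𝒜 g ≠ ⊥},
        ∀ y ∈ Subgroup.closure {g : G | 𝒜 g ≠ ⊥}, x * y = y * x) ∧
      LieAlgebra.radical F L = ⊥ ∧
      ∃ (n : ℕ) (B : Fin n → LieIdeal F L),
        DirectSum.IsInternal (fun i => (B i).toSubmodule) ∧
        (∀ i, LieAlgebra.IsSimple F ↥(B i)) ∧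
        ∀ i j, Nonempty (↥(B i) ≃ₗ⁅F⁆ ↥(B j)) := by
  have hcomm : ∀ a ∈ {g : G | 𝒜 g ≠ ⊥}, ∀ b ∈ {g : G | 𝒜 g ≠ ⊥}, a * b = b * a :=
    fun a ha b hb => hs.commute hgr ha hb
  have := hs.isKilling hgr
  refine ⟨?_, LieAlgebra.HasTrivialRadical.radical_eq_bot, ?_⟩
  · intro x hx y hy
    have := Subgroup.isMulCommutative_closure hcomm
    exact congrArg Subtype.val (mul_comm' (⟨x, hx⟩ : Subgroup.closure {g : G | 𝒜 g ≠ ⊥}) ⟨y, hy⟩)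
  · obtain ⟨n, B, hB, hatom⟩ := LieAlgebra.IsSemisimple.exists_isInternal_isAtom F L
    exact ⟨n, B, hB, fun i => LieAlgebra.IsSemisimple.isSimple_of_isAtom (B i) (hatom i),
      fun i j => hs.nonempty_lieEquiv hgr (hatom i) (hatom j)⟩
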